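/- Let $t\in(0,1)$ and define $F:(0,\pi)\to\mathbb{R}$ by $F(x)=\arcsin\frac{g(x)\sqrt{1-t^2}}{t-g(x)}$ where $g(x)=\frac{1+\cos x-\sqrt{(1+\cos x)^2-4t^2\cos x}}{2t}$. Then $F$ is strictly convex on $(0,\pi)$. -/

import Mathlib

open Real

/-- The squared derivative, up to a constant, increases in `y = sin F`. -/
lemma q_mono (s : ℝ) (hs0 : 0 < s) (hs1 : s < 1) (y1 y2 : ℝ) (h12 : y1 < y2)
    (hm : -1 < y1) (hp : 0 < s + y1) (hA : 0 < s + 2 * y1 + s * y1 ^ 2) (h1 : y2 < 1) :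
    (s + y1) ^ 2 * (s + 2 * y1 + s * y1 ^ 2) / (1 + 2 * s * y1 + y1 ^ 2) ^ 2 <
    (s + y2) ^ 2 * (s + 2 * y2 + s * y2 ^ 2) / (1 + 2 * s * y2 + y2 ^ 2) ^ 2 := by
  have hB : ∀ y : ℝ, 0 < 1 + 2 * s * y + y ^ 2 := fun y => by
    nlinarith [sq_nonneg (s + y)]
  have hd : ∀ y : ℝ, HasDerivAt
      (fun y : ℝ => (s + y) ^ 2 * (s + 2 * y + s * y ^ 2) / (1 + 2 * s * y + y ^ 2) ^ 2)
      (2 * (s + y) * ((1 - s ^ 2) * (3 * y + 2 * s - y ^ 3)) / (1 + 2 * s * y + y ^ 2) ^ 3) y := by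
    intro y
    have i := hasDerivAt_id' y
    have a := (i.const_add s).pow 2
    have b := ((i.const_mul 2).const_add s).add ((i.pow 2).const_mul s)
    have c := (((i.const_mul (2 * s)).const_add 1).add (i.pow 2)).pow 2
    have := (a.mul b).div c (by have := hB y; simp; positivity)
    refine this.congr_deriv ?_
    have h := (hB y).ne'
    simp
    field_simp
    ring
  have key : StrictMonoOn
      (fun y : ℝ => (s + y) ^ 2 * (s + 2 * y + s * y ^ 2) / (1 + 2 * s * y + y ^ 2) ^ 2)
      (Set.Icc y1 y2) := by
    apply strictMonoOn_of_deriv_pos (convex_Icc _ _)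
    · exact fun y _ => (hd y).continuousAt.continuousWithinAt
    · intro y hy
      rw [interior_Icc] at hy
      obtain ⟨hy1, hy2⟩ := hy
      rw [(hd y).deriv]
      have hA' : 0 < s + 2 * y + s * y ^ 2 := by
        have : 0 < (y - y1) * (2 + s * (y + y1)) := by
          apply mul_pos (by linarith)
          nlinarith
        nlinarith
      have hc : 0 < 3 * y + 2 * s - y ^ 3 := by
        rcases le_or_gt 0 y with h | h
        · nlinarith [mul_nonneg h h, mul_nonneg h (by linarith : (0:ℝ) ≤ 1 - y),
            mul_nonneg h (mul_nonneg (by linarith : (0:ℝ) ≤ 1 - y) (by linarith : (0:ℝ) ≤ 1 + y))]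
        · have h2 : 0 < (3 * y + 2 * s - y ^ 3) * (1 + y ^ 2) := by
            have : 0 ≤ (-y) * (1 - y ^ 2) ^ 2 := by
              have : 0 ≤ -y := by linarith
              positivity
            nlinarith
          exact pos_of_mul_pos_left h2 (by positivity)
      have h3 : 0 < 1 - s ^ 2 := by nlinarith
      have h4 : 0 < s + y := by linarith
      have := hB y
      positivity
  exact key ⟨le_rfl, h12.le⟩ ⟨h12.le, le_rfl⟩ h12

/-- All the facts about `y = (c - 1 + R) / (2 s)`. -/
lemma y_facts (s c R y : ℝ) (hs0 : 0 < s) (hs1 : s < 1) (hc1 : c < 1) (hc0 : -1 < c)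
    (hR : 0 ≤ R) (hRR : R ^ 2 = (1 - c) ^ 2 + 4 * s ^ 2 * c) (hy : y = (c - 1 + R) / (2 * s)) :
    -1 < y ∧ y < 1 ∧ 0 < s + y ∧ 0 < s + 2 * y + s * y ^ 2 ∧ R = 2 * s * y + 1 - c ∧
    (s + y) * c = y * (1 + s * y) := by
  have hRe : R = 2 * s * y + 1 - c := by rw [hy]; field_simp; ring
  have hm : -1 < y := by
    have : 1 - c - 2 * s < R := by
      apply lt_of_pow_lt_pow_left₀ 2 hR
      nlinarith [mul_pos (mul_pos hs0 (sub_pos.2 hs1)) (sub_pos.2 hc1)]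
    nlinarith
  have h1 : y < 1 := by
    have : R < 2 * s + 1 - c := by
      apply lt_of_pow_lt_pow_left₀ 2 (by linarith)
      nlinarith [mul_pos hs0 (sub_pos.2 hc1), mul_pos (mul_pos hs0 hs0) (sub_pos.2 hc1)]
    nlinarith
  have hp : 0 < s + y := by
    have : 1 - c - 2 * s ^ 2 < R := by
      apply lt_of_pow_lt_pow_left₀ 2 hR
      nlinarith [mul_pos (mul_pos hs0 hs0) (by nlinarith : 0 < 1 - s ^ 2)]
    nlinarith
  have he : (s + y) * c = y * (1 + s * y) := by
    rw [hRe] at hRR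
    have : 4 * s * ((s + y) * c - y * (1 + s * y)) = 0 := by linarith
    have := (mul_eq_zero.1 this).resolve_left (by positivity)
    linarith
  refine ⟨hm, h1, hp, ?_, hRe, he⟩
  nlinarith [mul_pos hp (by linarith : 0 < 1 + c)]

theorem F_strictConvex (t : ℝ) (ht : t ∈ Set.Ioo (0:ℝ) 1)
    (g F : ℝ → ℝ)
    (hg : ∀ x, g x = (1 + Real.cos x - Real.sqrt ((1 + Real.cos x) ^ 2 - 4 * t ^ 2 * Real.cos x)) / (2 * t))
    (hF : ∀ x, F x = Real.arcsin (g x * Real.sqrt (1 - t ^ 2) / (t - g x))) :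
    StrictConvexOn ℝ (Set.Ioo 0 Real.pi) F := by
  obtain ⟨ht0, ht1⟩ := ht
  obtain ⟨s, hs⟩ : ∃ s, s = Real.sqrt (1 - t ^ 2) := ⟨_, rfl⟩
  have hst : s ^ 2 = 1 - t ^ 2 := by rw [hs]; exact Real.sq_sqrt (by nlinarith)
  have hs0 : 0 < s := by rw [hs]; exact Real.sqrt_pos.2 (by nlinarith)
  have hs1 : s < 1 := by nlinarith
  obtain ⟨D, hD⟩ : ∃ D : ℝ → ℝ, D = fun x => (1 + cos x) ^ 2 - 4 * t ^ 2 * cos x := ⟨_, rfl⟩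
  obtain ⟨y, hy⟩ : ∃ y : ℝ → ℝ, y = fun x => (cos x - 1 + √(D x)) / (2 * s) := ⟨_, rfl⟩
  have hc : ∀ x ∈ Set.Ioo 0 π, -1 < cos x ∧ cos x < 1 ∧ 0 < sin x := by
    intro x hx
    have h := sin_pos_of_mem_Ioo hx
    have := sin_sq_add_cos_sq x
    refine ⟨?_, ?_, h⟩ <;> nlinarith
  have hDs : ∀ x, D x = (1 - cos x) ^ 2 + 4 * s ^ 2 * cos x := by
    intro x; rw [hD, hst]; ring
  have hDpos : ∀ x ∈ Set.Ioo 0 π, 0 < D x := by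
    intro x hx
    obtain ⟨h1, h2, -⟩ := hc x hx
    rcases le_or_gt 0 (cos x) with h | h
    · rw [hDs]
      have : 0 < 1 - cos x := by linarith
      positivity
    · rw [hD]
      have h3 : 0 < 1 + cos x := by linarith
      have h4 : 0 < -cos x := by linarith
      have : 0 < (1 + cos x) ^ 2 + 4 * t ^ 2 * (-cos x) := by positivity
      simp only; linarith
  have hfac : ∀ x ∈ Set.Ioo 0 π, -1 < y x ∧ y x < 1 ∧ 0 < s + y x ∧
      0 < s + 2 * y x + s * y x ^ 2 ∧ √(D x) = 2 * s * y x + 1 - cos x ∧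
      (s + y x) * cos x = y x * (1 + s * y x) := by
    intro x hx
    obtain ⟨h1, h2, -⟩ := hc x hx
    exact y_facts s (cos x) (√(D x)) (y x) hs0 hs1 h2 h1 (sqrt_nonneg _)
      (by rw [sq_sqrt (hDpos x hx).le, hDs]) (by rw [hy])
  have hFy : ∀ x ∈ Set.Ioo 0 π, F x = arcsin (y x) := by
    intro x hx
    obtain ⟨h1, h2, h3, h4, h5, h6⟩ := hfac x hx
    have e : √((1 + cos x) ^ 2 - 4 * t ^ 2 * cos x) = √(D x) := by rw [hD]
    rw [hF, hg, ← hs, e, h5]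
    congr 1
    have hne : t - (1 + cos x - (2 * s * y x + 1 - cos x)) / (2 * t) ≠ 0 := by
      have : t - (1 + cos x - (2 * s * y x + 1 - cos x)) / (2 * t)
          = (t ^ 2 - cos x + s * y x) / t := by field_simp; ring
      rw [this]
      apply div_ne_zero _ ht0.ne'
      intro h
      have h7 : (s + y x) * (t ^ 2 - cos x + s * y x) = s * t ^ 2 := by
        have : t ^ 2 = 1 - s ^ 2 := by linarith
        rw [this]; linear_combination -h6
      rw [h] at h7
      have : 0 < s * t ^ 2 := by positivity
      linarith
    rw [div_eq_iff hne]
    field_simp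
    have : t ^ 2 = 1 - s ^ 2 := by linarith
    rw [this]; linear_combination 2 * h6
  have hyd : ∀ x ∈ Set.Ioo 0 π, HasDerivAt y (-(sin x * (s + y x) / √(D x))) x := by
    intro x hx
    have hR : 0 < √(D x) := sqrt_pos.2 (hDpos x hx)
    obtain ⟨h1, h2, h3, h4, h5, h6⟩ := hfac x hx
    have c := hasDerivAt_cos x
    have hDd : HasDerivAt D (2 * (1 + cos x) * (-sin x) - 4 * t ^ 2 * (-sin x)) x := by
      rw [hD]
      refine (((c.const_add 1).pow 2).sub (c.const_mul (4 * t ^ 2))).congr_deriv ?_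
      simp
    have := ((c.sub_const 1).add (hDd.sqrt (hDpos x hx).ne')).div_const (2 * s)
    have h7 : HasDerivAt y ((-sin x + (2 * (1 + cos x) * (-sin x) - 4 * t ^ 2 * (-sin x)) / (2 * √(D x))) / (2 * s)) x := by
      rw [hy]; exact this
    refine h7.congr_deriv ?_
    field_simp
    have : t ^ 2 = 1 - s ^ 2 := by linarith
    rw [this, h5]; ring
  have hFd : ∀ x ∈ Set.Ioo 0 π, HasDerivAt F
      (1 / √(1 - y x ^ 2) * (-(sin x * (s + y x) / √(D x)))) x := by
    intro x hx
    obtain ⟨h1, h2, -⟩ := hfac x hx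
    have := (hasDerivAt_arcsin h1.ne' h2.ne).comp x (hyd x hx)
    apply this.congr_of_eventuallyEq
    filter_upwards [isOpen_Ioo.mem_nhds hx] with z hz
    exact hFy z hz
  have hyanti : StrictAntiOn y (Set.Ioo 0 π) := by
    apply strictAntiOn_of_deriv_neg (convex_Ioo _ _)
    · exact fun x hx => (hyd x hx).continuousAt.continuousWithinAt
    · intro x hx
      rw [interior_Ioo] at hx
      rw [(hyd x hx).deriv]
      have := sqrt_pos.2 (hDpos x hx)
      have := (hc x hx).2.2
      have := (hfac x hx).2.2.1
      rw [neg_lt_zero]; positivity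
  have hneg : ∀ x ∈ Set.Ioo 0 π, deriv F x < 0 := by
    intro x hx
    rw [(hFd x hx).deriv]
    have := sqrt_pos.2 (hDpos x hx)
    have := (hc x hx).2.2
    obtain ⟨h1, h2, h3, -⟩ := hfac x hx
    have : 0 < √(1 - y x ^ 2) := sqrt_pos.2 (by nlinarith)
    rw [mul_neg, neg_lt_zero]; positivity
  have hsq : ∀ x ∈ Set.Ioo 0 π, s * deriv F x ^ 2 =
      (s + y x) ^ 2 * (s + 2 * y x + s * y x ^ 2) / (1 + 2 * s * y x + y x ^ 2) ^ 2 := by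
    intro x hx
    rw [(hFd x hx).deriv]
    have hR := sqrt_pos.2 (hDpos x hx)
    obtain ⟨h1, h2, h3, h4, h5, h6⟩ := hfac x hx
    have hw : 0 < 1 - y x ^ 2 := by nlinarith
    have hB : 0 < 1 + 2 * s * y x + y x ^ 2 := by nlinarith [sq_nonneg (s + y x)]
    have hcx : cos x = y x * (1 + s * y x) / (s + y x) := by
      rw [eq_div_iff h3.ne']; linarith
    have hRx : √(D x) = s * (1 + 2 * s * y x + y x ^ 2) / (s + y x) := by
      rw [h5, hcx]; field_simp; ring
    have hsin : sin x ^ 2 = s * (1 - y x ^ 2) * (s + 2 * y x + s * y x ^ 2) / (s + y x) ^ 2 := by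
      rw [sin_sq, hcx]; field_simp; ring
    rw [mul_pow, neg_sq, div_pow, div_pow, mul_pow, sq_sqrt hw.le, hsin, hRx]
    field_simp
  apply StrictMonoOn.strictConvexOn_of_deriv (convex_Ioo _ _)
  · exact fun x hx => (hFd x hx).continuousAt.continuousWithinAt
  · rw [interior_Ioo]
    intro a ha b hb hab
    obtain ⟨h1, h2, h3, h4, -⟩ := hfac b hb
    have := q_mono s hs0 hs1 (y b) (y a) (hyanti ha hb hab) h1 h3 h4 (hfac a ha).2.1
    rw [← hsq a ha, ← hsq b hb] at this
    have h7 := lt_of_mul_lt_mul_left this hs0.le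
    have := hneg a ha
    have := hneg b hb
    nlinarith
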